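/- arXiv:1409.4398 — 5 statements merged into one kernel-verified Lean document; each statement's English description precedes it below -/
import Mathlib

section
/- Let U ⊆ ℝᵐ be open, let κ : U → ℝ be twice continuously differentiable with Δκ ≥ 0 on U, let u* be a constant with κ(x) < u* for all x ∈ U, and let 0 < a ≤ 1. Then ψ₂(x) = log(1 + (u* − κ(x))ᵃ) is strictly positive on U and satisfies Δψ₂ ≤ 0 on U (ψ₂ is superharmonic). -/
/-- The Euclidean Laplacian `Δf = Σᵢ ∂²f/∂xᵢ²` on `ℝᵐ`. -/
noncomputable def lap {m : ℕ} (f : (Fin m → ℝ) → ℝ) (x : Fin m → ℝ) : ℝ :=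
  ∑ i : Fin m, fderiv ℝ (fun y => fderiv ℝ f y (Pi.single i 1)) x (Pi.single i 1)

/-- Chain rule for the Laplacian of `φ ∘ f`, with `c` the second derivative of `φ` at `f x`. -/
theorem lap_comp {m : ℕ} {f : (Fin m → ℝ) → ℝ} {x : Fin m → ℝ} {φ φ' : ℝ → ℝ} {c : ℝ}
    (hf : ContDiffAt ℝ 2 f x) (hφ : ∀ᶠ t in nhds (f x), HasDerivAt φ (φ' t) t)
    (hφ' : HasDerivAt φ' c (f x)) :
    lap (fun y => φ (f y)) x =
      c * ∑ i : Fin m, (fderiv ℝ f x (Pi.single i 1)) ^ 2 + φ' (f x) * lap f x := by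
  have hfx : DifferentiableAt ℝ f x := hf.differentiableAt (by norm_num)
  have hf' : DifferentiableAt ℝ (fderiv ℝ f) x :=
    (hf.fderiv_right (m := 1) (by norm_num)).differentiableAt (by norm_num)
  have hev : ∀ᶠ y in nhds x, fderiv ℝ (fun y => φ (f y)) y = φ' (f y) • fderiv ℝ f y := by
    filter_upwards [hf.eventually (by simp), hfx.continuousAt.eventually hφ] with y hy hφy
    exact (hφy.comp_hasFDerivAt y (hy.differentiableAt (by norm_num)).hasFDerivAt).fderiv
  simp only [lap, Finset.mul_sum, ← Finset.sum_add_distrib]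
  refine Finset.sum_congr rfl fun i _ => ?_
  have hcongr : (fun y => fderiv ℝ (fun y => φ (f y)) y (Pi.single i 1)) =ᶠ[nhds x]
      fun y => φ' (f y) * fderiv ℝ f y (Pi.single i 1) := by
    filter_upwards [hev] with y hy
    simp [hy]
  have hpartial : DifferentiableAt ℝ (fun y => fderiv ℝ f y (Pi.single i 1)) x :=
    hf'.clm_apply (differentiableAt_const _)
  have hmul := (hφ'.comp_hasFDerivAt x hfx.hasFDerivAt).mul hpartial.hasFDerivAt
  rw [hcongr.fderiv_eq]
  have hval := DFunLike.congr_fun hmul.fderiv (Pi.single i 1)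
  simp only [add_apply, smul_apply, smul_eq_mul,
    Function.comp_apply] at hval
  refine Eq.trans hval ?_
  ring

theorem hasDerivAt_log_one_add_sub_rpow {u t : ℝ} (a : ℝ) (ht : t < u) :
    HasDerivAt (fun t => Real.log (1 + (u - t) ^ a))
      (-(a * (u - t) ^ (a - 1) / (1 + (u - t) ^ a))) t := by
  have hs : 0 < u - t := sub_pos.2 ht
  have hp : 0 < (u - t) ^ a := Real.rpow_pos_of_pos hs a
  have h := ((((hasDerivAt_id' t).const_sub u).rpow_const (p := a)
    (Or.inl hs.ne')).const_add 1).log (by positivity)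
  convert h using 1
  ring

theorem hasDerivAt_neg_mul_sub_rpow_div {u t : ℝ} (a : ℝ) (ht : t < u) :
    HasDerivAt (fun t => -(a * (u - t) ^ (a - 1) / (1 + (u - t) ^ a)))
      ((a * (a - 1) * (u - t) ^ (a - 1 - 1) * (1 + (u - t) ^ a)
        - (a * (u - t) ^ (a - 1)) ^ 2) / (1 + (u - t) ^ a) ^ 2) t := by
  have hs : 0 < u - t := sub_pos.2 ht
  have hp : 0 < (u - t) ^ a := Real.rpow_pos_of_pos hs a
  have hpow (p : ℝ) := ((hasDerivAt_id' t).const_sub u).rpow_const (p := p) (Or.inl hs.ne')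
  have h := (((hpow (a - 1)).const_mul a).div ((hpow a).const_add 1)
    (by positivity)).neg
  refine HasDerivAt.congr_deriv h ?_
  ring

/-- For `κ` C² and subharmonic on an open `U ⊆ ℝᵐ` with `κ < u*` and `0 < a ≤ 1`,
the shrinkage prior `ψ₂ = log(1 + (u* − κ)ᵃ)` is strictly positive and superharmonic on `U`. -/
theorem stmt6 {m : ℕ} (U : Set (Fin m → ℝ)) (hU : IsOpen U)
    (κ : (Fin m → ℝ) → ℝ) (hκ : ContDiffOn ℝ 2 κ U)
    (hsub : ∀ x ∈ U, 0 ≤ lap κ x)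
    (ustar : ℝ) (hbd : ∀ x ∈ U, κ x < ustar)
    (a : ℝ) (ha : 0 < a) (ha1 : a ≤ 1) :
    ∀ x ∈ U,
      0 < Real.log (1 + (ustar - κ x) ^ a) ∧
      lap (fun y => Real.log (1 + (ustar - κ y) ^ a)) x ≤ 0 := by
  intro x hx
  have hs : 0 < ustar - κ x := sub_pos.2 (hbd x hx)
  have hp : 0 < (ustar - κ x) ^ a := Real.rpow_pos_of_pos hs a
  refine ⟨Real.log_pos (by linarith), ?_⟩
  rw [lap_comp (hκ.contDiffAt (hU.mem_nhds hx))
    ((eventually_lt_nhds (hbd x hx)).mono fun t ht => hasDerivAt_log_one_add_sub_rpow a ht)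
    (hasDerivAt_neg_mul_sub_rpow_div a (hbd x hx))]
  have hnum : a * (a - 1) * (ustar - κ x) ^ (a - 1 - 1) * (1 + (ustar - κ x) ^ a) ≤ 0 :=
    mul_nonpos_of_nonpos_of_nonneg (mul_nonpos_of_nonpos_of_nonneg
      (mul_nonpos_of_nonneg_of_nonpos ha.le (by linarith)) (by positivity)) (by positivity)
  refine add_nonpos (mul_nonpos_of_nonpos_of_nonneg
    (div_nonpos_of_nonpos_of_nonneg ?_ (by positivity)) (by positivity))
    (mul_nonpos_of_nonpos_of_nonneg (neg_nonpos.2 (by positivity)) (hsub x hx))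
  linarith [sq_nonneg (a * (ustar - κ x) ^ (a - 1))]
end

section
/- Let p, q ≥ 0, d ∈ ℂ, and λ₁, …, λ_p, μ₁, …, μ_q ∈ ℂ with |λᵢ| < 1 and |μⱼ| < 1. For θ ∈ (0, 2π) define L(θ) = d·Log(1 − e^{−iθ}) + Σⱼ₌₁^q Log(1 − μⱼ e^{−iθ}) − Σᵢ₌₁^p Log(1 − λᵢ e^{−iθ}), where Log is the principal branch of the complex logarithm. Then (1/2π) ∫₀^{2π} |L(θ)|² dθ = Σ_{k=1}^∞ |d + (μ₁ᵏ + ⋯ + μ_qᵏ) − (λ₁ᵏ + ⋯ + λ_pᵏ)|² / k². -/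
open MeasureTheory Filter Topology

/-- The boundary value `θ ↦ Log (1 - a e^{-iθ})`. -/
noncomputable def circleLog (a : ℂ) (θ : ℝ) : ℂ :=
  Complex.log (1 - a * Complex.exp (-(θ : ℂ) * Complex.I))

/-- The Fourier coefficients of `circleLog a`. -/
noncomputable def logFourierCoeff (a : ℂ) : ℤ → ℂ
  | .ofNat _ => 0
  | .negSucc k => -(a ^ (k + 1) / ((k : ℂ) + 1))

lemma norm_mul_exp_neg_mul_I (a : ℂ) (θ : ℝ) :
    ‖a * Complex.exp (-(θ : ℂ) * Complex.I)‖ = ‖a‖ := by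
  rw [norm_mul, ← Complex.ofReal_neg, Complex.norm_exp_ofReal_mul_I, mul_one]

lemma fourierCoeffOn_two_pi (f : ℝ → ℂ) (n : ℤ) :
    fourierCoeffOn Real.two_pi_pos f n =
      (1 / (2 * Real.pi) : ℝ) • ∫ θ in (0 : ℝ)..2 * Real.pi,
        Complex.exp (-(n * θ) * Complex.I) * f θ := by
  rw [fourierCoeffOn_eq_integral, sub_zero]
  congr 1
  refine intervalIntegral.integral_congr fun θ _ => ?_
  simp only [smul_eq_mul]
  rw [fourier_coe_apply]
  congr 2
  push_cast
  field_simp [Real.pi_ne_zero]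

lemma integral_exp_int_mul_I (m : ℤ) :
    ∫ θ in (0 : ℝ)..2 * Real.pi, Complex.exp (m * θ * Complex.I) =
      if m = 0 then (2 * Real.pi : ℂ) else 0 := by
  split_ifs with hm
  · simp [hm]
  · have h : (m : ℂ) * Complex.I ≠ 0 := by simp [hm]
    have := integral_exp_mul_complex (a := 0) (b := 2 * Real.pi) h
    simp_rw [mul_right_comm _ Complex.I] at this
    rw [this]
    have h1 : Complex.exp (m * ((2 * Real.pi : ℝ) : ℂ) * Complex.I) = 1 := by
      rw [← Complex.exp_int_mul_two_pi_mul_I m]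
      congr 1
      push_cast
      ring
    rw [h1]
    simp

lemma measurable_circleLog (a : ℂ) : Measurable (circleLog a) := by
  unfold circleLog
  fun_prop

lemma one_sub_mem_slitPlane {w : ℂ} (hw : ‖w‖ ≤ 1) (h : w ≠ 1) : 1 - w ∈ Complex.slitPlane := by
  rw [Complex.mem_slitPlane_iff]
  by_contra! hc
  simp only [Complex.sub_re, Complex.one_re, Complex.sub_im, Complex.one_im] at hc
  have h1 := (Complex.re_le_norm w).trans hw
  exact h (Complex.ext (by simp; linarith) (by simp; linarith))

lemma continuous_circleLog {a : ℂ} (ha : ‖a‖ < 1) : Continuous (circleLog a) := by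
  refine Continuous.clog (by fun_prop) fun θ => ?_
  have h := norm_mul_exp_neg_mul_I a θ
  refine one_sub_mem_slitPlane (h.trans_le ha.le) fun h1 => ?_
  rw [h1, norm_one] at h
  exact ha.ne h.symm

lemma memLp_of_continuous_Ioc {f : ℝ → ℂ} (hf : Continuous f) (a b : ℝ) :
    MemLp f 2 (volume.restrict (Set.Ioc a b)) := by
  obtain ⟨C, hC⟩ := (isCompact_Icc (a := a) (b := b)).exists_bound_of_continuousOn hf.continuousOn
  refine MemLp.of_bound hf.aestronglyMeasurable C ?_
  filter_upwards [ae_restrict_mem measurableSet_Ioc] with x hx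
  exact hC x (Set.Ioc_subset_Icc_self hx)

lemma hasSum_circleLog {a : ℂ} (ha : ‖a‖ < 1) (θ : ℝ) :
    HasSum (fun k : ℕ => logFourierCoeff a (Int.negSucc k) *
      Complex.exp ((Int.negSucc k : ℤ) * θ * Complex.I)) (circleLog a θ) := by
  have h := (Complex.hasSum_taylorSeries_neg_log'
    ((norm_mul_exp_neg_mul_I a θ).trans_lt ha)).neg
  rw [neg_neg] at h
  convert! h using 2 with k
  rw [mul_pow, ← Complex.exp_nat_mul]
  simp only [logFourierCoeff, Int.cast_negSucc]
  push_cast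
  ring_nf

lemma norm_logFourierCoeff_le (a : ℂ) (k : ℕ) :
    ‖logFourierCoeff a (Int.negSucc k)‖ ≤ ‖a‖ ^ (k + 1) := by
  simp only [logFourierCoeff, norm_neg, norm_div, norm_pow]
  refine div_le_self (by positivity) ?_
  rw [← Nat.cast_succ, Complex.norm_natCast]
  simp

lemma fourierCoeffOn_circleLog_of_norm_lt_one {a : ℂ} (ha : ‖a‖ < 1) (n : ℤ) :
    fourierCoeffOn Real.two_pi_pos (circleLog a) n = logFourierCoeff a n := by
  rw [fourierCoeffOn_two_pi]
  have h : HasSum (fun k : ℕ => ∫ θ in (0 : ℝ)..2 * Real.pi,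
      Complex.exp (-(n * θ) * Complex.I) * (logFourierCoeff a (Int.negSucc k) *
        Complex.exp ((Int.negSucc k : ℤ) * θ * Complex.I)))
      (∫ θ in (0 : ℝ)..2 * Real.pi, Complex.exp (-(n * θ) * Complex.I) * circleLog a θ) := by
    refine intervalIntegral.hasSum_integral_of_dominated_convergence
      (fun k _ => ‖a‖ ^ (k + 1)) (fun k => by fun_prop) (fun k => .of_forall fun θ _ => ?_)
      (.of_forall fun θ _ => ?_) (by simp) (.of_forall fun θ _ => (hasSum_circleLog ha θ).mul_left _)
    · have h1 : ‖Complex.exp (-(n * θ) * Complex.I)‖ = 1 := by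
        simpa using Complex.norm_exp_ofReal_mul_I (-(n * θ))
      have h2 : ‖Complex.exp ((Int.negSucc k : ℤ) * θ * Complex.I)‖ = 1 := by
        simpa using Complex.norm_exp_ofReal_mul_I ((Int.negSucc k : ℤ) * θ)
      rw [norm_mul, norm_mul, h1, h2, one_mul, mul_one]
      exact norm_logFourierCoeff_le a k
    · exact (summable_nat_add_iff 1).2 (summable_geometric_of_lt_one (norm_nonneg a) ha)
  have h3 (k : ℕ) : ∫ θ in (0 : ℝ)..2 * Real.pi,
      Complex.exp (-(n * θ) * Complex.I) * (logFourierCoeff a (Int.negSucc k) *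
        Complex.exp ((Int.negSucc k : ℤ) * θ * Complex.I)) =
      if n = Int.negSucc k then (2 * Real.pi : ℂ) * logFourierCoeff a n else 0 := by
    have h4 := integral_exp_int_mul_I (Int.negSucc k - n)
    simp only [sub_eq_zero] at h4
    calc _ = logFourierCoeff a (Int.negSucc k) * ∫ θ in (0 : ℝ)..2 * Real.pi,
          Complex.exp (((Int.negSucc k - n : ℤ) : ℂ) * θ * Complex.I) := by
          rw [← intervalIntegral.integral_const_mul]
          refine intervalIntegral.integral_congr fun θ _ => ?_
          rw [mul_left_comm, ← Complex.exp_add]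
          congr 2
          push_cast
          ring
      _ = _ := by
          rw [h4]
          by_cases hk : n = Int.negSucc k
          · simp [hk, mul_comm]
          · simp [hk, Ne.symm hk]
  simp_rw [h3] at h
  suffices hs : HasSum (fun k : ℕ => if n = Int.negSucc k then
      (2 * Real.pi : ℂ) * logFourierCoeff a n else 0) ((2 * Real.pi : ℂ) * logFourierCoeff a n) by
    rw [h.unique hs, Complex.real_smul]
    have := Real.pi_ne_zero
    push_cast
    field_simp
  rcases n with m | m
  · simp [logFourierCoeff, hasSum_zero]
  · convert hasSum_ite_eq m ((2 * Real.pi : ℂ) * logFourierCoeff a (Int.negSucc m)) using 4 with k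
    simp [eq_comm]

lemma hasSum_norm_sq_logFourierCoeff_iff {c : ℤ → ℂ} (hc : ∀ n : ℕ, c n = 0) {s : ℝ} :
    HasSum (fun n : ℤ => ‖c n‖ ^ 2) s ↔ HasSum (fun k : ℕ => ‖c (Int.negSucc k)‖ ^ 2) s := by
  refine (Function.Injective.hasSum_iff (@Int.negSucc.inj) fun n hn => ?_).symm
  rcases n with m | m
  · simpa using hc m
  · exact absurd ⟨m, rfl⟩ hn

lemma integral_norm_sq_circleLog_le {a : ℂ} (ha : ‖a‖ < 1) :
    ∫ θ in (0 : ℝ)..2 * Real.pi, ‖circleLog a θ‖ ^ 2 ≤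
      2 * Real.pi * ∑' k : ℕ, 1 / ((k : ℝ) + 1) ^ 2 := by
  have h := hasSum_sq_fourierCoeffOn Real.two_pi_pos
    (memLp_of_continuous_Ioc (continuous_circleLog ha) 0 (2 * Real.pi))
  simp_rw [fourierCoeffOn_circleLog_of_norm_lt_one ha] at h
  rw [hasSum_norm_sq_logFourierCoeff_iff (fun n => rfl)] at h
  have hs : Summable fun k : ℕ => 1 / ((k : ℝ) + 1) ^ 2 := by
    exact_mod_cast (summable_nat_add_iff 1).2 (Real.summable_one_div_nat_pow.2 one_lt_two)
  have h1 := hasSum_le (fun k => ?_) h hs.hasSum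
  · rw [sub_zero, smul_eq_mul, inv_mul_le_iff₀ Real.two_pi_pos] at h1
    exact h1
  · simp only [logFourierCoeff, norm_neg, norm_div, norm_pow, div_pow]
    rw [← Nat.cast_succ, Complex.norm_natCast]
    push_cast
    gcongr
    exact pow_le_one₀ (by positivity) (pow_le_one₀ (norm_nonneg a) ha.le)

lemma ae_mul_exp_ne_one (a : ℂ) :
    ∀ᵐ θ : ℝ, a * Complex.exp (-(θ : ℂ) * Complex.I) ≠ 1 := by
  have h := ((Set.countable_singleton a).preimage_circleMap 0 one_ne_zero).measure_zero volume
  filter_upwards [measure_eq_zero_iff_ae_notMem.1 h] with θ hθ h1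
  apply hθ
  simp only [Set.mem_preimage, Set.mem_singleton_iff, circleMap, zero_add, Complex.ofReal_one,
    one_mul]
  rw [neg_mul, Complex.exp_neg] at h1
  exact (eq_of_mul_inv_eq_one h1).symm

lemma tendsto_circleLog {a : ℂ} (ha : ‖a‖ ≤ 1) {r : ℕ → ℝ} (hr : Tendsto r atTop (𝓝 1)) {θ : ℝ}
    (hθ : a * Complex.exp (-(θ : ℂ) * Complex.I) ≠ 1) :
    Tendsto (fun n => circleLog (r n * a) θ) atTop (𝓝 (circleLog a θ)) := by
  refine Tendsto.clog ?_ (one_sub_mem_slitPlane ((norm_mul_exp_neg_mul_I a θ).trans_le ha) hθ)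
  have h := (Complex.continuous_ofReal.tendsto 1).comp hr
  simpa using ((h.mul_const a).mul_const (Complex.exp (-(θ : ℂ) * Complex.I))).const_sub 1

lemma norm_mul_lt_one {a : ℂ} (ha : ‖a‖ ≤ 1) (n : ℕ) :
    ‖(((n : ℝ) / (n + 1) : ℝ) : ℂ) * a‖ < 1 := by
  have h : (n : ℝ) / (n + 1) < 1 := (div_lt_one (by positivity)).2 (lt_add_one _)
  rw [norm_mul, Complex.norm_of_nonneg (by positivity)]
  exact (mul_le_of_le_one_right (by positivity) ha).trans_lt h

lemma memLp_circleLog {a : ℂ} (ha : ‖a‖ ≤ 1) :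
    MemLp (circleLog a) 2 (volume.restrict (Set.Ioc 0 (2 * Real.pi))) := by
  refine ⟨(measurable_circleLog a).aestronglyMeasurable, ?_⟩
  refine (Lp.eLpNorm_lim_le_liminf_eLpNorm
    (f := fun n : ℕ => circleLog (((n : ℝ) / (n + 1) : ℝ) * a))
    (fun n => (measurable_circleLog _).aestronglyMeasurable) _ ?_).trans_lt ?_
  · filter_upwards [ae_restrict_of_ae (ae_mul_exp_ne_one a)] with θ hθ
    exact tendsto_circleLog ha (tendsto_natCast_div_add_atTop 1) hθ
  · refine (liminf_le_of_frequently_le' (x := ENNReal.ofReal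
      ((2 * Real.pi * ∑' k : ℕ, 1 / ((k : ℝ) + 1) ^ 2) ^ (2⁻¹ : ℝ)))
      (Frequently.of_forall fun n => ?_)).trans_lt ENNReal.ofReal_lt_top
    have hn := norm_mul_lt_one ha n
    rw [(memLp_of_continuous_Ioc (continuous_circleLog hn) _ _).eLpNorm_eq_integral_rpow_norm
      two_ne_zero ENNReal.ofNat_ne_top]
    have h := integral_norm_sq_circleLog_le hn
    rw [intervalIntegral.integral_of_le Real.two_pi_pos.le] at h
    simp only [ENNReal.toReal_ofNat, Real.rpow_ofNat]
    gcongr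

lemma norm_log_one_sub_mul_le {w : ℂ} (hw : ‖w‖ ≤ 1) (h1 : w ≠ 1) {r : ℝ} (hr0 : 0 ≤ r)
    (hr1 : r ≤ 1) :
    ‖Complex.log (1 - r * w)‖ ≤ ‖Complex.log (1 - w)‖ + Real.log 2 + Real.pi := by
  have hpos : 0 < ‖1 - w‖ := norm_pos_iff.2 (sub_ne_zero.2 h1.symm)
  have hrw : ‖(r : ℂ) * w‖ ≤ r := by
    rw [norm_mul, Complex.norm_of_nonneg hr0]
    exact mul_le_of_le_one_right hr0 hw
  have h2 : ‖1 - (r : ℂ) * w‖ ≤ 2 := by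
    have := norm_sub_le 1 ((r : ℂ) * w)
    rw [norm_one] at this
    linarith
  have h3 : ‖1 - w‖ ≤ 2 * ‖1 - (r : ℂ) * w‖ := by
    have e : 1 - w = (1 - (r : ℂ) * w) - ((1 - r : ℝ) : ℂ) * w := by push_cast; ring
    have i1 : ‖((1 - r : ℝ) : ℂ) * w‖ ≤ 1 - r := by
      rw [norm_mul, Complex.norm_of_nonneg (sub_nonneg.2 hr1)]
      exact mul_le_of_le_one_right (sub_nonneg.2 hr1) hw
    have i2 : 1 - r ≤ ‖1 - (r : ℂ) * w‖ := by
      have := norm_sub_norm_le 1 ((r : ℂ) * w)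
      rw [norm_one] at this
      linarith
    have i3 := norm_sub_le (1 - (r : ℂ) * w) (((1 - r : ℝ) : ℂ) * w)
    rw [← e] at i3
    linarith
  have hpos' : 0 < ‖1 - (r : ℂ) * w‖ := by linarith
  have h4 := Real.log_le_log hpos' h2
  have h5 := Real.log_le_log hpos h3
  rw [Real.log_mul two_ne_zero hpos'.ne'] at h5
  have h6 : |Real.log ‖1 - w‖| ≤ ‖Complex.log (1 - w)‖ := by
    simpa [Complex.log_re] using Complex.abs_re_le_norm (Complex.log (1 - w))
  have h7 : |Real.log ‖1 - (r : ℂ) * w‖| ≤ ‖Complex.log (1 - w)‖ + Real.log 2 := by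
    rw [abs_le]
    constructor <;> linarith [neg_abs_le (Real.log ‖1 - w‖), norm_nonneg (Complex.log (1 - w))]
  refine (Complex.norm_le_abs_re_add_abs_im _).trans ?_
  rw [Complex.log_re, Complex.log_im]
  exact add_le_add h7 (Complex.abs_arg_le_pi _)

lemma tendsto_logFourierCoeff (a : ℂ) {r : ℕ → ℝ} (hr : Tendsto r atTop (𝓝 1)) (n : ℤ) :
    Tendsto (fun m => logFourierCoeff (r m * a) n) atTop (𝓝 (logFourierCoeff a n)) := by
  have h := ((Complex.continuous_ofReal.tendsto 1).comp hr).mul_const a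
  rw [Complex.ofReal_one, one_mul] at h
  rcases n with k | k
  · exact tendsto_const_nhds
  · exact ((h.pow (k + 1)).div_const _).neg

lemma intervalIntegrable_circleLog {a : ℂ} (ha : ‖a‖ ≤ 1) :
    IntervalIntegrable (circleLog a) volume 0 (2 * Real.pi) :=
  (intervalIntegrable_iff_integrableOn_Ioc_of_le Real.two_pi_pos.le).2
    ((memLp_circleLog ha).integrable one_le_two)

lemma fourierCoeffOn_circleLog {a : ℂ} (ha : ‖a‖ ≤ 1) (n : ℤ) :
    fourierCoeffOn Real.two_pi_pos (circleLog a) n = logFourierCoeff a n := by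
  have hr := tendsto_natCast_div_add_atTop (1 : ℝ)
  refine tendsto_nhds_unique ?_ (tendsto_logFourierCoeff a hr n)
  simp_rw [← fun m : ℕ => fourierCoeffOn_circleLog_of_norm_lt_one (norm_mul_lt_one ha m) n,
    fourierCoeffOn_two_pi]
  refine Tendsto.const_smul ?_ _
  refine intervalIntegral.tendsto_integral_filter_of_dominated_convergence
    (fun θ => ‖circleLog a θ‖ + Real.log 2 + Real.pi) (.of_forall fun m => ?_)
    (.of_forall fun m => ?_) ?_ ?_
  · have := measurable_circleLog (((m : ℝ) / (m + 1) : ℝ) * a)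
    exact Measurable.aestronglyMeasurable (by fun_prop)
  · filter_upwards [ae_mul_exp_ne_one a] with θ hθ _
    have h1 : ‖Complex.exp (-(n * θ) * Complex.I)‖ = 1 := by
      simpa using Complex.norm_exp_ofReal_mul_I (-(n * θ))
    rw [norm_mul, h1, one_mul, circleLog, mul_assoc]
    exact norm_log_one_sub_mul_le ((norm_mul_exp_neg_mul_I a θ).trans_le ha) hθ (by positivity)
      ((div_le_one (by positivity)).2 (lt_add_one _).le)
  · exact ((intervalIntegrable_circleLog ha).norm.add intervalIntegrable_const).add
      intervalIntegrable_const
  · filter_upwards [ae_mul_exp_ne_one a] with θ hθ _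
    exact (tendsto_circleLog ha hr hθ).const_mul _


/-- Parseval identity for the boundary log-transfer function of the ARFIMA(p,d,q)
model: with `L(θ) = d·Log(1 − e^{−iθ}) + Σⱼ Log(1 − μⱼe^{−iθ}) − Σᵢ Log(1 − λᵢe^{−iθ})`
(principal branch), the squared Hardy norm `(1/2π)∫₀^{2π}|L(θ)|² dθ` equals the Kähler
potential series `Σ_{k≥1} |d + Σⱼμⱼᵏ − Σᵢλᵢᵏ|²/k²`. -/
theorem stmt13 (p q : ℕ) (d : ℂ) (l : Fin p → ℂ) (μ : Fin q → ℂ)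
    (hl : ∀ i, ‖l i‖ < 1) (hμ : ∀ j, ‖μ j‖ < 1) :
    (1 / (2 * Real.pi)) *
        ∫ θ in (0 : ℝ)..(2 * Real.pi),
          ‖d * Complex.log (1 - Complex.exp (-(θ : ℂ) * Complex.I))
            + ∑ j : Fin q, Complex.log (1 - μ j * Complex.exp (-(θ : ℂ) * Complex.I))
            - ∑ i : Fin p, Complex.log (1 - l i * Complex.exp (-(θ : ℂ) * Complex.I))‖ ^ 2
      = ∑' k : ℕ,
          ‖d + ∑ j : Fin q, μ j ^ (k + 1) - ∑ i : Fin p, l i ^ (k + 1)‖ ^ 2 /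
            ((k : ℝ) + 1) ^ 2 := by
  let F : ℝ → ℂ := fun θ =>
    d * circleLog 1 θ + ∑ j, circleLog (μ j) θ - ∑ i, circleLog (l i) θ
  let c : ℤ → ℂ := fun n =>
    d * logFourierCoeff 1 n + ∑ j, logFourierCoeff (μ j) n - ∑ i, logFourierCoeff (l i) n
  have hF : MemLp F 2 (volume.restrict (Set.Ioc 0 (2 * Real.pi))) :=
    (((memLp_circleLog norm_one.le).const_mul d).add
      (memLp_finsetSum _ fun j _ => memLp_circleLog (hμ j).le)).sub
      (memLp_finsetSum _ fun i _ => memLp_circleLog (hl i).le)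
  have hc (n : ℤ) : fourierCoeffOn Real.two_pi_pos F n = c n := by
    have hint {a : ℂ} (ha : ‖a‖ ≤ 1) : IntervalIntegrable
        (fun θ : ℝ => Complex.exp (-(n * θ) * Complex.I) * circleLog a θ)
        volume 0 (2 * Real.pi) :=
      (intervalIntegrable_circleLog ha).continuousOn_mul (by fun_prop)
    have h1 := (hint norm_one.le).const_mul d
    have h2 := IntervalIntegrable.sum Finset.univ fun j _ => hint (hμ j).le
    have h3 := IntervalIntegrable.sum Finset.univ fun i _ => hint (hl i).le
    simp only [Finset.sum_fn] at h2 h3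
    simp only [c]
    simp_rw [← fourierCoeffOn_circleLog norm_one.le, ← fun j => fourierCoeffOn_circleLog (hμ j).le,
      ← fun i => fourierCoeffOn_circleLog (hl i).le, fourierCoeffOn_two_pi, ← Finset.smul_sum,
      mul_smul_comm, ← smul_add, ← smul_sub]
    congr 1
    rw [← intervalIntegral.integral_finsetSum fun j _ => hint (hμ j).le,
      ← intervalIntegral.integral_finsetSum fun i _ => hint (hl i).le,
      ← intervalIntegral.integral_const_mul, ← intervalIntegral.integral_add h1 h2,
      ← intervalIntegral.integral_sub (h1.add h2) h3]
    refine intervalIntegral.integral_congr fun θ _ => ?_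
    simp only [F, ← Finset.mul_sum]
    ring
  have h := hasSum_sq_fourierCoeffOn Real.two_pi_pos hF
  simp_rw [hc] at h
  rw [hasSum_norm_sq_logFourierCoeff_iff (fun n => by simp [c, logFourierCoeff])] at h
  rw [sub_zero, smul_eq_mul, ← one_div] at h
  simp only [F, circleLog, one_mul] at h
  rw [← h.tsum_eq]
  refine tsum_congr fun k => ?_
  have hk : c (Int.negSucc k) =
      -((d + ∑ j, μ j ^ (k + 1) - ∑ i, l i ^ (k + 1)) / ((k + 1 : ℕ) : ℂ)) := by
    simp only [c, logFourierCoeff, Finset.sum_neg_distrib, ← Finset.sum_div, one_pow]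
    push_cast
    ring
  rw [hk, norm_neg, norm_div, Complex.norm_natCast, div_pow]
  push_cast
  rfl
end

section
/- Let p, q ≥ 0 and define 𝒦(d, λ, μ) = Σ_{k=1}^∞ |d + (μ₁ᵏ + ⋯ + μ_qᵏ) − (λ₁ᵏ + ⋯ + λ_pᵏ)|² / k² for d ∈ ℂ and λ ∈ 𝔻^p, μ ∈ 𝔻^q (𝔻 the open unit disk). Then 𝒦 is twice continuously differentiable and its Euclidean Laplacian in all 1+p+q complex variables (identifying ℂ^{1+p+q} with ℝ^{2(1+p+q)}) equals Δ𝒦 = 2π²/3 + 4 Σᵢ₌₁^p 1/(1 − |λᵢ|²) + 4 Σⱼ₌₁^q 1/(1 − |μⱼ|²) > 0; in particular, the ARFIMA Kähler potential is strictly subharmonic on ℂ × 𝔻^p × 𝔻^q. -/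
/-- Second directional derivative of `f` at `x` in direction `v`. -/
noncomputable def secondDeriv {E : Type*} [NormedAddCommGroup E] [NormedSpace ℝ E]
    (f : E → ℝ) (x v : E) : ℝ :=
  fderiv ℝ (fun y => fderiv ℝ f y v) x v

/-- The Euclidean Laplacian on `ℂ × ℂᵖ × ℂ^q` identified with `ℝ^{2(1+p+q)}`:
the sum of second derivatives along the real and imaginary unit directions of
each complex coordinate. -/
noncomputable def lapProd {p q : ℕ} (f : ℂ × (Fin p → ℂ) × (Fin q → ℂ) → ℝ)
    (x : ℂ × (Fin p → ℂ) × (Fin q → ℂ)) : ℝ :=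
  (secondDeriv f x (1, 0, 0) + secondDeriv f x (Complex.I, 0, 0))
    + ∑ i : Fin p,
        (secondDeriv f x (0, Pi.single i 1, 0) +
          secondDeriv f x (0, Pi.single i Complex.I, 0))
    + ∑ j : Fin q,
        (secondDeriv f x (0, 0, Pi.single j 1) +
          secondDeriv f x (0, 0, Pi.single j Complex.I))

open scoped InnerProductSpace

section NormSq

variable {E H : Type*} [NormedAddCommGroup E] [NormedSpace ℂ E] [NormedSpace ℝ E]
  [IsScalarTower ℝ ℂ E] [NormedAddCommGroup H] [InnerProductSpace ℂ H] [NormedSpace ℝ H]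

theorem HasFDerivAt.re_inner {G : Type*} [NormedAddCommGroup G] [NormedSpace ℝ G]
    {f g : G → H} {f' g' : G →L[ℝ] H} {x : G} (hf : HasFDerivAt f f' x)
    (hg : HasFDerivAt g g' x) (v : G) :
    fderiv ℝ (fun y => (⟪f y, g y⟫_ℂ).re) x v = (⟪f x, g' v⟫_ℂ + ⟪f' v, g x⟫_ℂ).re := by
  have h := Complex.reCLM.hasFDerivAt.comp x (hf.inner ℂ hg)
  have h' : (Complex.reCLM ∘ fun y => ⟪f y, g y⟫_ℂ) = fun y => (⟪f y, g y⟫_ℂ).re := rfl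
  rw [h'] at h
  rw [h.fderiv]
  simp

variable [IsScalarTower ℝ ℂ H]

theorem secondDeriv_norm_sq {Φ : E → H} {f : E → ℝ} {x : E} (hΦ : ContDiffAt ℂ 2 Φ x)
    (hf : f =ᶠ[nhds x] fun y => ‖Φ y‖ ^ 2) (v : E) :
    secondDeriv f x v =
      2 * ((⟪Φ x, fderiv ℂ (fderiv ℂ Φ) x v v⟫_ℂ).re + ‖fderiv ℂ Φ x v‖ ^ 2) := by
  have hdiff : ∀ᶠ y in nhds x, HasFDerivAt Φ ((fderiv ℂ Φ y).restrictScalars ℝ) y := by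
    filter_upwards [hΦ.eventually (by simp)] with y hy
    exact (hy.differentiableAt (by simp)).hasFDerivAt.restrictScalars ℝ
  have hD : HasFDerivAt (fun y => fderiv ℂ Φ y v)
      (((ContinuousLinearMap.apply ℂ H v).comp (fderiv ℂ (fderiv ℂ Φ) x)).restrictScalars ℝ) x := by
    have h1 : DifferentiableAt ℂ (fderiv ℂ Φ) x :=
      (hΦ.fderiv_right (m := 1) (by norm_num)).differentiableAt (by simp)
    exact ((ContinuousLinearMap.apply ℂ H v).hasFDerivAt.comp x
      h1.hasFDerivAt).restrictScalars ℝ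
  have hfirst : (fun y => fderiv ℝ f y v) =ᶠ[nhds x]
      fun y => 2 * (⟪Φ y, fderiv ℂ Φ y v⟫_ℂ).re := by
    filter_upwards [hf.eventuallyEq_nhds, hdiff] with y hy hd
    have hre : (fun z => ‖Φ z‖ ^ 2) = fun z => (⟪Φ z, Φ z⟫_ℂ).re := by
      funext z
      exact norm_sq_eq_re_inner (𝕜 := ℂ) (Φ z)
    rw [hy.fderiv_eq, hre, hd.re_inner hd, Complex.add_re]
    have := inner_re_symm (𝕜 := ℂ) (fderiv ℂ Φ y v) (Φ y)
    simp only [RCLike.re_eq_complex_re] at this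
    simp [this]
    ring
  have hd2 : DifferentiableAt ℝ (fun y => (⟪Φ y, fderiv ℂ Φ y v⟫_ℂ).re) x :=
    (Complex.reCLM.hasFDerivAt.comp x (hdiff.self_of_nhds.inner ℂ hD)).differentiableAt
  rw [secondDeriv, hfirst.fderiv_eq, fderiv_const_mul hd2, _root_.smul_apply,
    hdiff.self_of_nhds.re_inner hD, Complex.add_re]
  have := norm_sq_eq_re_inner (𝕜 := ℂ) (fderiv ℂ Φ x v)
  simp only [RCLike.re_eq_complex_re] at this
  simp [this]

/-- The squared norm of a holomorphic map is plurisubharmonic: its Laplacian along the complex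
line spanned by `v` is `4 ‖∂Φ v‖²`. -/
theorem secondDeriv_norm_sq_add_I_smul {Φ : E → H} {f : E → ℝ} {x : E}
    (hΦ : ContDiffAt ℂ 2 Φ x) (hf : f =ᶠ[nhds x] fun y => ‖Φ y‖ ^ 2) (v : E) :
    secondDeriv f x v + secondDeriv f x (Complex.I • v) = 4 * ‖fderiv ℂ Φ x v‖ ^ 2 := by
  rw [secondDeriv_norm_sq hΦ hf, secondDeriv_norm_sq hΦ hf]
  simp [norm_smul, smul_smul]
  ring

end NormSq

theorem norm_natCast_add_one (k : ℕ) : ‖(k : ℂ) + 1‖ = (k : ℝ) + 1 := by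
  rw [← Nat.cast_add_one, Complex.norm_natCast, Nat.cast_add_one]

/-- The square-summable complex sequences. -/
abbrev EllTwo : Type := lp (fun _ : ℕ => ℂ) 2

theorem EllTwo.hasSum_norm_sq (f : EllTwo) : HasSum (fun k => ‖f k‖ ^ 2) (‖f‖ ^ 2) := by
  simpa using lp.hasSum_norm (p := 2) (by simp) f

/-- The sequence `1 / (k + 1)`. -/
noncomputable def harmonicSeq : EllTwo :=
  ⟨fun k => 1 / ((k : ℂ) + 1), memℓp_gen (by
    have h := (summable_nat_add_iff 1).2 hasSum_zeta_two.summable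
    exact h.congr fun k => by simp [norm_natCast_add_one])⟩

theorem harmonicSeq_apply (k : ℕ) : harmonicSeq k = 1 / ((k : ℂ) + 1) := rfl

theorem norm_harmonicSeq_sq : ‖harmonicSeq‖ ^ 2 = Real.pi ^ 2 / 6 := by
  refine (EllTwo.hasSum_norm_sq harmonicSeq).unique ?_
  have h := (hasSum_nat_add_iff' 1).2 hasSum_zeta_two
  simpa [harmonicSeq_apply, norm_natCast_add_one] using h

/-- The curve `z ↦ (z ^ (k + 1) / (k + 1))ₖ`. -/
noncomputable def powerSeq (z : ℂ) : EllTwo :=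
  ∑' k : ℕ, lp.single 2 k (z ^ (k + 1) / ((k : ℂ) + 1))

theorem norm_powerSeq_term_le {r : ℝ} {z : ℂ} (hz : ‖z‖ ≤ r) (k : ℕ) :
    ‖(lp.single 2 k (z ^ (k + 1) / ((k : ℂ) + 1)) : EllTwo)‖ ≤ r ^ (k + 1) := by
  rw [lp.norm_single (by simp), norm_div, norm_pow, norm_natCast_add_one]
  calc ‖z‖ ^ (k + 1) / ((k : ℝ) + 1) ≤ ‖z‖ ^ (k + 1) :=
        div_le_self (by positivity) (by linarith [(Nat.cast_nonneg k : (0 : ℝ) ≤ k)])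
    _ ≤ r ^ (k + 1) := by gcongr

theorem summable_pow_add_one {r : ℝ} (h0 : 0 ≤ r) (h1 : r < 1) :
    Summable fun k : ℕ => r ^ (k + 1) :=
  (summable_nat_add_iff 1).2 (summable_geometric_of_lt_one h0 h1)

theorem powerSeq_apply {z : ℂ} (hz : ‖z‖ < 1) (k : ℕ) :
    powerSeq z k = z ^ (k + 1) / ((k : ℂ) + 1) := by
  have hs : Summable fun k : ℕ => (lp.single 2 k (z ^ (k + 1) / ((k : ℂ) + 1)) : EllTwo) :=
    .of_norm_bounded (summable_pow_add_one (norm_nonneg z) hz) (norm_powerSeq_term_le le_rfl)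
  have h := (lp.evalCLM ℂ (fun _ : ℕ => ℂ) 2 k).map_tsum hs
  refine h.trans ((tsum_eq_single k fun j hj => ?_).trans ?_)
  · exact lp.single_apply_ne 2 j _ hj.symm
  · exact lp.single_apply_self 2 k _

theorem differentiableOn_powerSeq : DifferentiableOn ℂ powerSeq (Metric.ball 0 1) := by
  intro z hz
  obtain ⟨r, hzr, hr⟩ := exists_between (mem_ball_zero_iff.1 hz)
  have h : DifferentiableOn ℂ powerSeq (Metric.ball 0 r) := by
    refine Complex.differentiableOn_tsum_of_summable_norm
      (summable_pow_add_one ((norm_nonneg z).trans hzr.le) hr) (fun k => ?_) Metric.isOpen_ball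
      fun k w hw => norm_powerSeq_term_le (mem_ball_zero_iff.1 hw).le k
    have : Differentiable ℂ fun w : ℂ => w ^ (k + 1) / ((k : ℂ) + 1) := by fun_prop
    exact ((lp.singleContinuousLinearMap ℂ (fun _ : ℕ => ℂ) 2 k).differentiable.comp
      this).differentiableOn
  exact (h.differentiableAt
    (Metric.isOpen_ball.mem_nhds (mem_ball_zero_iff.2 hzr))).differentiableWithinAt

theorem contDiffAt_powerSeq {z : ℂ} (hz : ‖z‖ < 1) : ContDiffAt ℂ 2 powerSeq z :=
  (differentiableOn_powerSeq.contDiffOn Metric.isOpen_ball).contDiffAt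
    (Metric.isOpen_ball.mem_nhds (mem_ball_zero_iff.2 hz))

theorem deriv_powerSeq_apply {z : ℂ} (hz : ‖z‖ < 1) (k : ℕ) : deriv powerSeq z k = z ^ k := by
  have hd := ((contDiffAt_powerSeq hz).differentiableAt (by simp)).hasDerivAt
  have h1 := (lp.evalCLM ℂ (fun _ : ℕ => ℂ) 2 k).hasFDerivAt.comp_hasDerivAt z hd
  have h2 : HasDerivAt (fun w : ℂ => w ^ (k + 1) / ((k : ℂ) + 1)) (z ^ k) z := by
    convert! (hasDerivAt_pow (k + 1) z).div_const ((k : ℂ) + 1) using 1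
    have : (k : ℂ) + 1 ≠ 0 := Nat.cast_add_one_ne_zero k
    push_cast
    field_simp
  refine h1.unique (h2.congr_of_eventuallyEq ?_)
  filter_upwards [Metric.isOpen_ball.mem_nhds (mem_ball_zero_iff.2 hz)] with w hw
  exact powerSeq_apply (mem_ball_zero_iff.1 hw) k

theorem norm_deriv_powerSeq_sq {z : ℂ} (hz : ‖z‖ < 1) :
    ‖deriv powerSeq z‖ ^ 2 = 1 / (1 - ‖z‖ ^ 2) := by
  refine (EllTwo.hasSum_norm_sq _).unique ?_
  have h := hasSum_geometric_of_lt_one (sq_nonneg ‖z‖)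
    (pow_lt_one₀ (norm_nonneg z) hz two_ne_zero)
  simpa [deriv_powerSeq_apply hz, ← pow_mul, mul_comm] using h

section Arfima

variable {p q : ℕ}

/-- The holomorphic map into `ℓ²` whose squared norm is the ARFIMA Kähler potential: the
coefficients of the logarithm of the transfer function. -/
noncomputable def arfimaMap (x : ℂ × (Fin p → ℂ) × (Fin q → ℂ)) : EllTwo :=
  x.1 • harmonicSeq + ∑ j, powerSeq (x.2.2 j) - ∑ i, powerSeq (x.2.1 i)

/-- The parameter domain `ℂ × 𝔻ᵖ × 𝔻^q`. -/
def arfimaDomain (p q : ℕ) : Set (ℂ × (Fin p → ℂ) × (Fin q → ℂ)) :=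
  {x | (∀ i, ‖x.2.1 i‖ < 1) ∧ (∀ j, ‖x.2.2 j‖ < 1)}

/-- The Kähler potential of the ARFIMA model. -/
noncomputable def arfimaPotential (x : ℂ × (Fin p → ℂ) × (Fin q → ℂ)) : ℝ :=
  ∑' k : ℕ,
    ‖x.1 + ∑ j : Fin q, x.2.2 j ^ (k + 1) - ∑ i : Fin p, x.2.1 i ^ (k + 1)‖ ^ 2 /
      ((k : ℝ) + 1) ^ 2

theorem isOpen_arfimaDomain : IsOpen (arfimaDomain p q) := by
  simp only [arfimaDomain, Set.ofPred_and, Set.ofPred_forall]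
  exact (isOpen_iInter_of_finite fun i => isOpen_lt (by fun_prop) (by fun_prop)).inter
    (isOpen_iInter_of_finite fun i => isOpen_lt (by fun_prop) (by fun_prop))

theorem arfimaPotential_eq_norm_sq {x : ℂ × (Fin p → ℂ) × (Fin q → ℂ)}
    (hx : x ∈ arfimaDomain p q) : arfimaPotential x = ‖arfimaMap x‖ ^ 2 := by
  rw [← (EllTwo.hasSum_norm_sq (arfimaMap x)).tsum_eq, arfimaPotential]
  refine tsum_congr fun k => ?_
  have h : arfimaMap x k =
      (x.1 + ∑ j, x.2.2 j ^ (k + 1) - ∑ i, x.2.1 i ^ (k + 1)) / ((k : ℂ) + 1) := by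
    simp only [arfimaMap, lp.coeFn_sub, lp.coeFn_add, lp.coeFn_smul, lp.coeFn_sum, Pi.sub_apply,
      Pi.add_apply, Pi.smul_apply, Finset.sum_apply, harmonicSeq_apply, powerSeq_apply (hx.1 _),
      powerSeq_apply (hx.2 _), smul_eq_mul, ← Finset.sum_div]
    ring
  rw [h, norm_div, norm_natCast_add_one, div_pow]

theorem arfimaPotential_eventuallyEq {x : ℂ × (Fin p → ℂ) × (Fin q → ℂ)}
    (hx : x ∈ arfimaDomain p q) : arfimaPotential =ᶠ[nhds x] fun y => ‖arfimaMap y‖ ^ 2 := by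
  filter_upwards [isOpen_arfimaDomain.mem_nhds hx] with y hy using arfimaPotential_eq_norm_sq hy

theorem contDiffAt_arfimaMap {x : ℂ × (Fin p → ℂ) × (Fin q → ℂ)} (hx : x ∈ arfimaDomain p q) :
    ContDiffAt ℂ 2 arfimaMap x := by
  have hμ (j : Fin q) : ContDiffAt ℂ 2
      (fun y : ℂ × (Fin p → ℂ) × (Fin q → ℂ) => powerSeq (y.2.2 j)) x :=
    (contDiffAt_powerSeq (hx.2 j)).comp x (f := fun y => y.2.2 j) (by fun_prop)
  have hl (i : Fin p) : ContDiffAt ℂ 2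
      (fun y : ℂ × (Fin p → ℂ) × (Fin q → ℂ) => powerSeq (y.2.1 i)) x :=
    (contDiffAt_powerSeq (hx.1 i)).comp x (f := fun y => y.2.1 i) (by fun_prop)
  exact ((contDiffAt_fst.smul contDiffAt_const).add (ContDiffAt.sum fun j _ => hμ j)).sub
    (ContDiffAt.sum fun i _ => hl i)

theorem fderiv_arfimaMap_apply {x : ℂ × (Fin p → ℂ) × (Fin q → ℂ)} (hx : x ∈ arfimaDomain p q)
    (v : ℂ × (Fin p → ℂ) × (Fin q → ℂ)) :
    fderiv ℂ arfimaMap x v = v.1 • harmonicSeq + ∑ j, v.2.2 j • deriv powerSeq (x.2.2 j)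
      - ∑ i, v.2.1 i • deriv powerSeq (x.2.1 i) := by
  have hpow {z : ℂ} (hz : ‖z‖ < 1) : HasDerivAt powerSeq (deriv powerSeq z) z :=
    ((contDiffAt_powerSeq hz).differentiableAt (by simp)).hasDerivAt
  have hline : HasDerivAt (fun t : ℂ => arfimaMap (x + t • v))
      (v.1 • harmonicSeq + ∑ j, v.2.2 j • deriv powerSeq (x.2.2 j)
        - ∑ i, v.2.1 i • deriv powerSeq (x.2.1 i)) 0 := by
    have haff (a b : ℂ) : HasDerivAt (fun t : ℂ => a + t * b) b 0 := by
      simpa using ((hasDerivAt_id (0 : ℂ)).mul_const b).const_add a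
    have hcomp (a b : ℂ) (ha : ‖a‖ < 1) :
        HasDerivAt (fun t : ℂ => powerSeq (a + t * b)) (b • deriv powerSeq a) 0 :=
      HasDerivAt.scomp_of_eq (h := fun t : ℂ => a + t * b) 0 (hpow ha) (haff a b) (by simp)
    exact (((haff x.1 v.1).smul_const harmonicSeq).add
      (HasDerivAt.fun_sum fun j _ => hcomp _ _ (hx.2 j))).sub
      (HasDerivAt.fun_sum fun i _ => hcomp _ _ (hx.1 i))
  have hd := ((contDiffAt_arfimaMap hx).differentiableAt (by simp)).hasFDerivAt
  exact (hd.hasLineDerivAt v).unique hline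

theorem lapProd_arfimaPotential {x : ℂ × (Fin p → ℂ) × (Fin q → ℂ)}
    (hx : x ∈ arfimaDomain p q) :
    lapProd arfimaPotential x = 2 * Real.pi ^ 2 / 3 + 4 * ∑ i : Fin p, 1 / (1 - ‖x.2.1 i‖ ^ 2)
      + 4 * ∑ j : Fin q, 1 / (1 - ‖x.2.2 j‖ ^ 2) := by
  have key := secondDeriv_norm_sq_add_I_smul (contDiffAt_arfimaMap hx)
    (arfimaPotential_eventuallyEq hx)
  have h0 := key (1, 0, 0)
  have hl (i : Fin p) := key (0, Pi.single i 1, 0)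
  have hμ (j : Fin q) := key (0, 0, Pi.single j 1)
  simp only [fderiv_arfimaMap_apply hx, Prod.smul_mk, smul_zero, smul_eq_mul, mul_one,
    mul_zero,
    ← Pi.single_smul, Pi.single_apply, Pi.zero_apply, zero_smul, one_smul, ite_smul,
    Finset.sum_ite_eq', Finset.sum_const_zero, Finset.mem_univ, if_true, add_zero, zero_add,
    sub_zero, zero_sub, norm_neg, norm_harmonicSeq_sq, norm_deriv_powerSeq_sq (hx.1 _),
    norm_deriv_powerSeq_sq (hx.2 _)] at h0 hl hμ
  simp only [lapProd, h0, hl, hμ, ← Finset.mul_sum]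
  ring

end Arfima

/-- The ARFIMA(p,d,q) Kähler potential
`𝒦(d,λ,μ) = Σ_{k≥1} |d + Σⱼμⱼᵏ − Σᵢλᵢᵏ|²/k²` is C² on `ℂ × 𝔻ᵖ × 𝔻^q` and its
Euclidean Laplacian in all `1+p+q` complex variables equals
`2π²/3 + 4Σᵢ 1/(1−|λᵢ|²) + 4Σⱼ 1/(1−|μⱼ|²) > 0`; in particular it is strictly
subharmonic. -/
theorem stmt14 (p q : ℕ) :
    let K : ℂ × (Fin p → ℂ) × (Fin q → ℂ) → ℝ := fun x =>
      ∑' k : ℕ,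
        ‖x.1 + ∑ j : Fin q, x.2.2 j ^ (k + 1) - ∑ i : Fin p, x.2.1 i ^ (k + 1)‖ ^ 2 /
          ((k : ℝ) + 1) ^ 2
    let S : Set (ℂ × (Fin p → ℂ) × (Fin q → ℂ)) :=
      {x | (∀ i, ‖x.2.1 i‖ < 1) ∧ (∀ j, ‖x.2.2 j‖ < 1)}
    ContDiffOn ℝ 2 K S ∧
    ∀ x ∈ S,
      lapProd K x
          = 2 * Real.pi ^ 2 / 3 + 4 * ∑ i : Fin p, 1 / (1 - ‖x.2.1 i‖ ^ 2)
            + 4 * ∑ j : Fin q, 1 / (1 - ‖x.2.2 j‖ ^ 2) ∧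
      0 < lapProd K x := by
  intro K S
  refine ⟨fun x hx => ?_, fun x hx => ?_⟩
  · exact ((((contDiffAt_arfimaMap hx).restrict_scalars ℝ).norm_sq ℂ).congr_of_eventuallyEq
      (arfimaPotential_eventuallyEq hx)).contDiffWithinAt
  · have h : lapProd K x = _ := lapProd_arfimaPotential hx
    refine ⟨h, h ▸ ?_⟩
    have hpos {z : ℂ} (hz : ‖z‖ < 1) : 0 ≤ 1 / (1 - ‖z‖ ^ 2) :=
      one_div_nonneg.2 (sub_nonneg.2 (pow_le_one₀ (norm_nonneg z) hz.le))
    have h1 := Finset.sum_nonneg fun i (_ : i ∈ Finset.univ) => hpos (hx.1 i)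
    have h2 := Finset.sum_nonneg fun j (_ : j ∈ Finset.univ) => hpos (hx.2 j)
    have := Real.pi_pos
    positivity
end

section
/- Fix d ∈ ℂ and define K : 𝔻 → ℝ by K(λ) = Σ_{k=1}^∞ |d − λᵏ|² / k², where 𝔻 ⊆ ℂ is the open unit disk. Then K is twice continuously differentiable on 𝔻 and its Euclidean Laplacian (identifying ℂ with ℝ²) satisfies ΔK(λ) = 4/(1 − |λ|²) for all λ ∈ 𝔻. -/
/-- The Euclidean Laplacian `Δ = ∂²/∂x² + ∂²/∂y²` on `ℂ` identified with `ℝ²`. -/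
noncomputable def lap1 (f : ℂ → ℝ) (z : ℂ) : ℝ :=
  fderiv ℝ (fun y => fderiv ℝ f y 1) z 1 +
    fderiv ℝ (fun y => fderiv ℝ f y Complex.I) z Complex.I

open ComplexConjugate Topology

/-- The dilogarithm series `∑ z ^ n / n ^ 2`. -/
noncomputable def dilog (z : ℂ) : ℂ := ∑' k : ℕ, z ^ (k + 1) / ((k : ℂ) + 1) ^ 2

theorem summable_one_div_add_one_sq : Summable fun k : ℕ => 1 / ((k : ℝ) + 1) ^ 2 := by
  have := (summable_nat_add_iff 1).mpr (Real.summable_one_div_nat_pow.mpr (one_lt_two))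
  simpa using this

theorem norm_dilog_term_le (k : ℕ) {z : ℂ} (hz : ‖z‖ ≤ 1) :
    ‖z ^ (k + 1) / ((k : ℂ) + 1) ^ 2‖ ≤ 1 / ((k : ℝ) + 1) ^ 2 := by
  have h : ‖(k : ℂ) + 1‖ = (k : ℝ) + 1 := by
    rw [← Nat.cast_add_one, Complex.norm_natCast, Nat.cast_add_one]
  rw [norm_div, norm_pow, norm_pow, h]
  gcongr
  exact pow_le_one₀ (norm_nonneg z) hz

theorem hasSum_dilog {z : ℂ} (hz : ‖z‖ ≤ 1) :
    HasSum (fun k : ℕ => z ^ (k + 1) / ((k : ℂ) + 1) ^ 2) (dilog z) :=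
  (Summable.of_norm_bounded summable_one_div_add_one_sq
    fun k => norm_dilog_term_le k hz).hasSum

theorem isOpen_norm_lt_one : IsOpen {z : ℂ | ‖z‖ < 1} :=
  isOpen_lt continuous_norm continuous_const

theorem differentiableOn_dilog : DifferentiableOn ℂ dilog {z : ℂ | ‖z‖ < 1} :=
  Complex.differentiableOn_tsum_of_summable_norm summable_one_div_add_one_sq
    (fun _ => by fun_prop) isOpen_norm_lt_one fun k _ hw => norm_dilog_term_le k (le_of_lt hw)

theorem differentiableOn_deriv_dilog : DifferentiableOn ℂ (deriv dilog) {z : ℂ | ‖z‖ < 1} :=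
  differentiableOn_dilog.deriv isOpen_norm_lt_one

theorem mul_deriv_dilog {z : ℂ} (hz : ‖z‖ < 1) :
    z * deriv dilog z = -Complex.log (1 - z) := by
  have h := Complex.hasSum_deriv_of_summable_norm summable_one_div_add_one_sq
    (F := fun (k : ℕ) (z : ℂ) => z ^ (k + 1) / ((k : ℂ) + 1) ^ 2)
    (fun _ => by fun_prop) isOpen_norm_lt_one (fun k _ hw => norm_dilog_term_le k (le_of_lt hw)) hz
  have h' := (hasSum_nat_add_iff' 1).mpr (Complex.hasSum_taylorSeries_neg_log hz)
  simp only [Finset.range_one, Finset.sum_singleton, Nat.cast_zero, div_zero, sub_zero] at h'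
  have hterm (k : ℕ) : z * deriv (fun z : ℂ => z ^ (k + 1) / ((k : ℂ) + 1) ^ 2) z
      = z ^ (k + 1) / ((k + 1 : ℕ) : ℂ) := by
    have hk : (k : ℂ) + 1 ≠ 0 := Nat.cast_add_one_ne_zero k
    rw [deriv_div_const, deriv_pow_field]
    push_cast
    field_simp
    simp [pow_succ']
  simp only [← hterm] at h'
  exact (h.mul_left z).unique h'

theorem deriv_dilog_add_mul_deriv {z : ℂ} (hz : ‖z‖ < 1) :
    deriv dilog z + z * deriv (deriv dilog) z = 1 / (1 - z) := by
  have hd : HasDerivAt (deriv dilog) (deriv (deriv dilog) z) z :=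
    (differentiableOn_deriv_dilog.differentiableAt
      (isOpen_norm_lt_one.mem_nhds hz)).hasDerivAt
  have h1 := (hasDerivAt_id z).mul hd
  have hs : 1 - z ∈ Complex.slitPlane := by
    rw [sub_eq_add_neg]
    exact Complex.mem_slitPlane_of_norm_lt_one (by simpa using hz)
  have h2 := (((hasDerivAt_id z).const_sub 1).clog hs).neg
  have h3 := h2.congr_of_eventuallyEq (f₁ := fun w => w * deriv dilog w) (by
    filter_upwards [isOpen_norm_lt_one.mem_nhds hz] with w hw using mul_deriv_dilog hw)
  have := h1.unique h3
  simpa [neg_div] using this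

theorem hasFDerivAt_comp_mul_conj {Q : ℂ → ℂ} {q y : ℂ} (hQ : HasDerivAt Q q (y * conj y)) :
    ∃ L : ℂ →L[ℝ] ℂ, HasFDerivAt (fun y => Q (y * conj y)) L y ∧
      ∀ v, L v = q * (y * conj v + conj y * v) := by
  have hc : HasFDerivAt (fun y : ℂ => conj y) (Complex.conjCLE : ℂ →L[ℝ] ℂ) y :=
    Complex.conjCLE.hasFDerivAt
  have hm := (hasFDerivAt_id (𝕜 := ℝ) y).mul hc
  refine ⟨_, (hQ.hasFDerivAt.restrictScalars ℝ).comp y hm, fun v => ?_⟩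
  simp
  ring

theorem fderiv_re_add_comp_mul_conj {P Q : ℂ → ℂ} {p q y : ℂ} (hP : HasDerivAt P p y)
    (hQ : HasDerivAt Q q (y * conj y)) (v : ℂ) :
    fderiv ℝ (fun y => (P y + Q (y * conj y)).re) y v
      = (p * v + q * (y * conj v + conj y * v)).re := by
  obtain ⟨L, hL, hLv⟩ := hasFDerivAt_comp_mul_conj hQ
  have h : HasFDerivAt (fun y => (P y + Q (y * conj y)).re) _ y :=
    Complex.reCLM.hasFDerivAt.comp y ((hP.hasFDerivAt.restrictScalars ℝ).add hL)
  rw [h.fderiv]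
  simp [hLv, mul_comm]

theorem fderiv_re_mul_add_comp_mul_conj_mul {P Q : ℂ → ℂ} {p q y : ℂ} (hP : HasDerivAt P p y)
    (hQ : HasDerivAt Q q (y * conj y)) (v : ℂ) :
    fderiv ℝ (fun y => (P y * v + Q (y * conj y) * (y * conj v + conj y * v)).re) y v
      = (p * v ^ 2 + q * (y * conj v + conj y * v) ^ 2
          + Q (y * conj y) * (2 * (v * conj v))).re := by
  obtain ⟨L, hL, hLv⟩ := hasFDerivAt_comp_mul_conj hQ
  have hc : HasFDerivAt (fun y : ℂ => conj y) (Complex.conjCLE : ℂ →L[ℝ] ℂ) y :=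
    Complex.conjCLE.hasFDerivAt
  have hl := ((hasFDerivAt_id (𝕜 := ℝ) y).mul_const (conj v)).add (hc.mul_const v)
  have h : HasFDerivAt
      (fun y => (P y * v + Q (y * conj y) * (y * conj v + conj y * v)).re) _ y :=
    Complex.reCLM.hasFDerivAt.comp y
      (((hP.hasFDerivAt.restrictScalars ℝ).mul_const v).add (hL.mul hl))
  rw [h.fderiv]
  simp only [ContinuousLinearMap.comp_apply, Complex.reCLM_apply]
  congr 1
  simp [hLv]
  ring

theorem lap1_congr {f g : ℂ → ℝ} {z : ℂ} (h : f =ᶠ[𝓝 z] g) : lap1 f z = lap1 g z := by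
  have (v : ℂ) : (fun y => fderiv ℝ f y v) =ᶠ[𝓝 z] fun y => fderiv ℝ g y v :=
    (h.fderiv (𝕜 := ℝ)).mono fun y hy => by simp only [hy]
  simp only [lap1, (this _).fderiv_eq]

theorem norm_mul_conj_lt_one {z : ℂ} (hz : ‖z‖ < 1) : ‖z * conj z‖ < 1 := by
  rw [norm_mul, RCLike.norm_conj]
  nlinarith [norm_nonneg z]

theorem lap1_re_add_comp_mul_conj {P Q : ℂ → ℂ} (hP : DifferentiableOn ℂ P {z | ‖z‖ < 1})
    (hQ : DifferentiableOn ℂ Q {z | ‖z‖ < 1}) {z : ℂ} (hz : ‖z‖ < 1) :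
    lap1 (fun y => (P y + Q (y * conj y)).re) z
      = (4 * (deriv Q (z * conj z) + z * conj z * deriv (deriv Q) (z * conj z))).re := by
  have hD {f : ℂ → ℂ} (hf : DifferentiableOn ℂ f {z | ‖z‖ < 1}) {w : ℂ} (hw : ‖w‖ < 1) :
      HasDerivAt f (deriv f w) w :=
    (hf.differentiableAt (isOpen_norm_lt_one.mem_nhds hw)).hasDerivAt
  have key (v : ℂ) :
      fderiv ℝ (fun y => fderiv ℝ (fun y => (P y + Q (y * conj y)).re) y v) z v
        = (deriv (deriv P) z * v ^ 2
            + deriv (deriv Q) (z * conj z) * (z * conj v + conj z * v) ^ 2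
            + deriv Q (z * conj z) * (2 * (v * conj v))).re := by
    have h : (fun y => fderiv ℝ (fun y => (P y + Q (y * conj y)).re) y v) =ᶠ[𝓝 z] fun y =>
        (deriv P y * v + deriv Q (y * conj y) * (y * conj v + conj y * v)).re := by
      filter_upwards [isOpen_norm_lt_one.mem_nhds hz] with y hy using
        fderiv_re_add_comp_mul_conj (hD hP hy) (hD hQ (norm_mul_conj_lt_one hy)) v
    rw [h.fderiv_eq]
    exact fderiv_re_mul_add_comp_mul_conj_mul (hD (hP.deriv isOpen_norm_lt_one) hz)
      (hD (hQ.deriv isOpen_norm_lt_one) (norm_mul_conj_lt_one hz)) v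
  rw [lap1, key, key, ← Complex.add_re]
  congr 1
  simp only [map_one, Complex.conj_I]
  linear_combination (deriv (deriv P) z + deriv (deriv Q) (z * conj z) * (z - conj z) ^ 2
    - 2 * deriv Q (z * conj z)) * Complex.I_sq

theorem tsum_norm_sub_pow_sq_div (d : ℂ) {z : ℂ} (hz : ‖z‖ < 1) :
    ∑' k : ℕ, ‖d - z ^ (k + 1)‖ ^ 2 / ((k : ℝ) + 1) ^ 2
      = ((d * conj d * dilog 1 - 2 * conj d * dilog z) + dilog (z * conj z)).re := by
  have h := Complex.hasSum_re ((((hasSum_dilog (z := 1) (by simp)).mul_left (d * conj d)).sub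
    ((hasSum_dilog hz.le).mul_left (2 * conj d))).add
      (hasSum_dilog (norm_mul_conj_lt_one hz).le))
  rw [← h.tsum_eq]
  refine tsum_congr fun k => ?_
  rw [← mul_div_assoc, ← mul_div_assoc, ← sub_div, ← add_div, one_pow, mul_one, mul_pow,
    ← map_pow]
  have hk : ((k : ℂ) + 1) ^ 2 = (((k : ℝ) + 1) ^ 2 : ℝ) := by push_cast; rfl
  rw [hk, Complex.div_ofReal_re, ← Complex.normSq_eq_norm_sq]
  congr 1
  generalize z ^ (k + 1) = w
  simp [Complex.normSq_apply]
  ring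

/-- The ARFIMA(1,d,0) Kähler potential `K(λ) = Σ_{k≥1} |d − λᵏ|²/k²` is C² on the open
unit disk and its Euclidean Laplacian satisfies `ΔK(λ) = 4/(1 − |λ|²)`, encoding the
metric component `g_{λλ̄} = 1/(1 − λλ̄)`. -/
theorem stmt15 (d : ℂ) :
    let K : ℂ → ℝ := fun l => ∑' k : ℕ, ‖d - l ^ (k + 1)‖ ^ 2 / ((k : ℝ) + 1) ^ 2
    ContDiffOn ℝ 2 K {z : ℂ | ‖z‖ < 1} ∧
    ∀ l : ℂ, ‖l‖ < 1 → lap1 K l = 4 / (1 - ‖l‖ ^ 2) := by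
  intro K
  constructor
  · have hF : ContDiffOn ℝ 2 dilog {z : ℂ | ‖z‖ < 1} :=
      (differentiableOn_dilog.contDiffOn isOpen_norm_lt_one).restrict_scalars ℝ
    have hc : ContDiff ℝ 2 fun z : ℂ => z * conj z :=
      contDiff_id.mul Complex.conjCLE.contDiff
    have hG : ContDiffOn ℝ 2
        (fun z => (d * conj d * dilog 1 - 2 * conj d * dilog z) + dilog (z * conj z))
        {z : ℂ | ‖z‖ < 1} :=
      (contDiffOn_const.sub (contDiffOn_const.mul hF)).add
        (hF.comp hc.contDiffOn fun _ hz => norm_mul_conj_lt_one hz)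
    exact (Complex.reCLM.contDiff.comp_contDiffOn hG).congr
      fun z hz => tsum_norm_sub_pow_sq_div d hz
  · intro l hl
    have hK : K =ᶠ[𝓝 l] fun z =>
        ((d * conj d * dilog 1 - 2 * conj d * dilog z) + dilog (z * conj z)).re := by
      filter_upwards [isOpen_norm_lt_one.mem_nhds hl] with z hz using tsum_norm_sub_pow_sq_div d hz
    rw [lap1_congr hK, lap1_re_add_comp_mul_conj
      (P := fun z => d * conj d * dilog 1 - 2 * conj d * dilog z)
      ((differentiableOn_dilog.const_mul _).const_sub _) differentiableOn_dilog hl,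
      deriv_dilog_add_mul_deriv (norm_mul_conj_lt_one hl), Complex.mul_conj',
      mul_one_div]
    norm_cast
end

section
/- Let p, q ≥ 0 and fix λ₁, …, λ_p, μ₁, …, μ_q ∈ ℂ with |λᵢ| < 1 and |μⱼ| < 1. Define K : ℂ → ℝ by K(d) = Σ_{k=1}^∞ |d + (μ₁ᵏ + ⋯ + μ_qᵏ) − (λ₁ᵏ + ⋯ + λ_pᵏ)|² / k². Then K is twice continuously differentiable and its Euclidean Laplacian in d (identifying ℂ with ℝ²) is the constant ΔK = 2π²/3. -/
/-- A weighted sum of squared distances `∑ w k * ‖d + c k‖ ^ 2` with summable weights and bounded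
centres is a quadratic polynomial in the real coordinates of `d`. -/
theorem exists_tsum_weighted_norm_add_sq_eq {w : ℕ → ℝ} (hw : Summable w) {c : ℕ → ℂ} {M : ℝ}
    (hc : ∀ k, ‖c k‖ ≤ M) :
    ∃ A B C : ℝ, ∀ d : ℂ, ∑' k, w k * ‖d + c k‖ ^ 2 =
      (∑' k, w k) * (d.re ^ 2 + d.im ^ 2) + A * d.re + B * d.im + C := by
  have summable_mul {b : ℕ → ℝ} {N : ℝ} (hb : ∀ k, |b k| ≤ N) : Summable fun k => w k * b k :=
    Summable.of_norm_bounded (hw.abs.mul_right N) fun k => by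
      rw [Real.norm_eq_abs, abs_mul]
      exact mul_le_mul_of_nonneg_left (hb k) (abs_nonneg _)
  have hre := summable_mul fun k => (Complex.abs_re_le_norm (c k)).trans (hc k)
  have him := summable_mul fun k => (Complex.abs_im_le_norm (c k)).trans (hc k)
  have hsq : Summable fun k => w k * ‖c k‖ ^ 2 := summable_mul (N := M ^ 2) fun k => by
    rw [abs_of_nonneg (by positivity)]
    exact pow_le_pow_left₀ (norm_nonneg _) (hc k) 2
  refine ⟨(∑' k, w k * (c k).re) * 2, (∑' k, w k * (c k).im) * 2, ∑' k, w k * ‖c k‖ ^ 2,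
    fun d => ?_⟩
  have h := (((hw.hasSum.mul_right (d.re ^ 2 + d.im ^ 2)).add
    ((hre.hasSum.mul_right 2).mul_right d.re)).add
    ((him.hasSum.mul_right 2).mul_right d.im)).add hsq.hasSum
  refine Eq.trans (tsum_congr fun k => ?_) h.tsum_eq
  simp only [Complex.sq_norm, Complex.normSq_apply, Complex.add_re, Complex.add_im]
  ring

theorem contDiff_quadratic_re_im (S A B C : ℝ) {n : WithTop ℕ∞} :
    ContDiff ℝ n fun d : ℂ => S * (d.re ^ 2 + d.im ^ 2) + A * d.re + B * d.im + C := by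
  have hre : ContDiff ℝ n Complex.re := Complex.reCLM.contDiff
  have him : ContDiff ℝ n Complex.im := Complex.imCLM.contDiff
  fun_prop

theorem lap1_quadratic_re_im (S A B C : ℝ) (z : ℂ) :
    lap1 (fun d : ℂ => S * (d.re ^ 2 + d.im ^ 2) + A * d.re + B * d.im + C) z = 4 * S := by
  have hre (y : ℂ) : HasFDerivAt Complex.re Complex.reCLM y := Complex.reCLM.hasFDerivAt
  have him (y : ℂ) : HasFDerivAt Complex.im Complex.imCLM y := Complex.imCLM.hasFDerivAt
  have hf (y : ℂ) := ((((((hre y).pow 2).add ((him y).pow 2)).const_mul S).add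
    ((hre y).const_mul A)).add ((him y).const_mul B)).add_const C
  have h_one (y : ℂ) : fderiv ℝ
      (fun d : ℂ => S * (d.re ^ 2 + d.im ^ 2) + A * d.re + B * d.im + C) y 1 =
      2 * S * y.re + A := by
    refine (congrArg (fun T : ℂ →L[ℝ] ℝ => T 1) (hf y).fderiv).trans ?_
    simp
    ring
  have h_I (y : ℂ) : fderiv ℝ
      (fun d : ℂ => S * (d.re ^ 2 + d.im ^ 2) + A * d.re + B * d.im + C) y Complex.I =
      2 * S * y.im + B := by
    refine (congrArg (fun T : ℂ →L[ℝ] ℝ => T Complex.I) (hf y).fderiv).trans ?_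
    simp
    ring
  simp only [lap1, h_one, h_I]
  rw [(((hre z).const_mul (2 * S)).add_const A).fderiv,
    (((him z).const_mul (2 * S)).add_const B).fderiv]
  simp
  ring

theorem norm_sum_pow_le_card {ι : Type*} [Fintype ι] {a : ι → ℂ} (ha : ∀ i, ‖a i‖ ≤ 1) (n : ℕ) :
    ‖∑ i, a i ^ n‖ ≤ Fintype.card ι := by
  refine (norm_sum_le_of_le Finset.univ (f := fun i => a i ^ n) (n := fun _ => 1)
    fun i _ => ?_).trans (by simp)
  rw [norm_pow]
  exact pow_le_one₀ (norm_nonneg _) (ha i)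

theorem hasSum_inv_add_one_sq : HasSum (fun k : ℕ => (((k : ℝ) + 1) ^ 2)⁻¹) (Real.pi ^ 2 / 6) := by
  simpa using (hasSum_nat_add_iff' 1).mpr hasSum_zeta_two

/-- With AR poles `λᵢ` and MA roots `μⱼ` fixed in the open unit disk, the ARFIMA
Kähler potential `K(d) = Σ_{k≥1} |d + Σⱼμⱼᵏ − Σᵢλᵢᵏ|²/k²`, as a function of the
fractional differencing parameter `d`, is C² with constant Laplacian `ΔK = 2π²/3`,
encoding the metric component `g_{dd̄} = π²/6`. -/
theorem stmt16 (p q : ℕ) (l : Fin p → ℂ) (μ : Fin q → ℂ)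
    (hl : ∀ i, ‖l i‖ < 1) (hμ : ∀ j, ‖μ j‖ < 1) :
    let K : ℂ → ℝ := fun d =>
      ∑' k : ℕ,
        ‖d + ∑ j : Fin q, μ j ^ (k + 1) - ∑ i : Fin p, l i ^ (k + 1)‖ ^ 2 /
          ((k : ℝ) + 1) ^ 2
    ContDiff ℝ 2 K ∧ ∀ d : ℂ, lap1 K d = 2 * Real.pi ^ 2 / 3 := by
  intro K
  have hc (k : ℕ) : ‖∑ j, μ j ^ (k + 1) - ∑ i, l i ^ (k + 1)‖ ≤
      Fintype.card (Fin q) + Fintype.card (Fin p) :=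
    (norm_sub_le _ _).trans (add_le_add (norm_sum_pow_le_card (fun j => (hμ j).le) _)
      (norm_sum_pow_le_card (fun i => (hl i).le) _))
  obtain ⟨A, B, C, h⟩ := exists_tsum_weighted_norm_add_sq_eq hasSum_inv_add_one_sq.summable hc
  have hK : K = fun d => Real.pi ^ 2 / 6 * (d.re ^ 2 + d.im ^ 2) + A * d.re + B * d.im + C := by
    funext d
    rw [← hasSum_inv_add_one_sq.tsum_eq, ← h d]
    exact tsum_congr fun k => by rw [add_sub_assoc, div_eq_inv_mul]
  rw [hK]
  refine ⟨contDiff_quadratic_re_im _ _ _ _, fun d => ?_⟩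
  rw [lap1_quadratic_re_im]
  ring
end
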